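/- arXiv:1806.06497 — 3 statements merged into one kernel-verified Lean document; each statement's English description precedes it below -/
import Mathlib

section
/- Let P and Q be n×n real symmetric positive semidefinite matrices, R an m×m real symmetric positive definite matrix, A an n×n real matrix and B an n×m real matrix. Then Ω(P,Q,R,A,B) = Φ(P,Ψ(P,R,A,B),Q,R,A,B), and for every m×n real matrix K one has Ω(P,Q,R,A,B) ⪯ Φ(P,K,Q,R,A,B) in the Loewner order; that is, Ω(P,Q,R,A,B) = min over K of Φ(P,K,Q,R,A,B), the minimum being attained at K = Ψ(P,R,A,B). -/
open Matrix

/-- `Ω(P,Q,R,A,B) = Q + AᵀPA − AᵀPB(R + BᵀPB)⁻¹BᵀPA`. -/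
noncomputable def Omega {n m : Type*} [Fintype n] [Fintype m] [DecidableEq m]
    (P Q : Matrix n n ℝ) (R : Matrix m m ℝ) (A : Matrix n n ℝ) (B : Matrix n m ℝ) :
    Matrix n n ℝ :=
  Q + Aᵀ * P * A - Aᵀ * P * B * (R + Bᵀ * P * B)⁻¹ * (Bᵀ * P * A)

/-- `Ψ(P,R,A,B) = −(R + BᵀPB)⁻¹BᵀPA`. -/
noncomputable def Psi {n m : Type*} [Fintype n] [Fintype m] [DecidableEq m]
    (P : Matrix n n ℝ) (R : Matrix m m ℝ) (A : Matrix n n ℝ) (B : Matrix n m ℝ) :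
    Matrix m n ℝ :=
  -((R + Bᵀ * P * B)⁻¹ * (Bᵀ * P * A))

/-- `Φ(P,K,Q,R,A,B) = Q + KᵀRK + (A+BK)ᵀP(A+BK)`. -/
def Phi {n m : Type*} [Fintype n] [Fintype m]
    (P : Matrix n n ℝ) (K : Matrix m n ℝ) (Q : Matrix n n ℝ) (R : Matrix m m ℝ)
    (A : Matrix n n ℝ) (B : Matrix n m ℝ) : Matrix n n ℝ :=
  Q + Kᵀ * R * K + (A + B * K)ᵀ * P * (A + B * K)


/-- Completing the square: `Φ(P,K,Q,R,A,B)` exceeds `Ω(P,Q,R,A,B)` by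
`(K - Ψ)ᵀ(R + BᵀPB)(K - Ψ)`. -/
theorem Phi_eq_Omega_add {n m : Type*} [Fintype n] [Fintype m] [DecidableEq m]
    {P : Matrix n n ℝ} {R : Matrix m m ℝ} {B : Matrix n m ℝ} (hP : P.IsSymm) (hR : R.IsSymm)
    (hS : IsUnit (R + Bᵀ * P * B)) (Q A : Matrix n n ℝ) (K : Matrix m n ℝ) :
    Phi P K Q R A B = Omega P Q R A B +
      (K - Psi P R A B)ᵀ * (R + Bᵀ * P * B) * (K - Psi P R A B) := by
  have hSΨ : (R + Bᵀ * P * B) * Psi P R A B = -(Bᵀ * P * A) := by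
    rw [Psi, Matrix.mul_neg, Matrix.mul_nonsing_inv_cancel_left _ _
      ((Matrix.isUnit_iff_isUnit_det _).mp hS)]
  have hΨS : (Psi P R A B)ᵀ * (R + Bᵀ * P * B) = -(Aᵀ * P * B) := by
    simpa [Matrix.transpose_mul, hP.eq, hR.eq, Matrix.mul_assoc] using congrArg transpose hSΨ
  have hΩ : Omega P Q R A B = Q + Aᵀ * P * A + Aᵀ * P * B * Psi P R A B := by
    simp only [Omega, Psi, Matrix.mul_neg, Matrix.mul_assoc, sub_eq_add_neg]
  have hsq : (K - Psi P R A B)ᵀ * (R + Bᵀ * P * B) * (K - Psi P R A B) =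
      Kᵀ * (R + Bᵀ * P * B) * K + Kᵀ * (Bᵀ * P * A) + Aᵀ * P * B * K
        - Aᵀ * P * B * Psi P R A B := by
    rw [transpose_sub, Matrix.sub_mul, hΨS, Matrix.mul_sub, Matrix.sub_mul, Matrix.sub_mul,
      Matrix.mul_assoc Kᵀ _ (Psi P R A B), hSΨ]
    simp only [Matrix.neg_mul, Matrix.mul_neg]
    abel
  rw [hΩ, hsq, Phi]
  simp only [transpose_add, transpose_mul, Matrix.add_mul, Matrix.mul_add, Matrix.mul_assoc]
  abel

theorem stmt1 {n m : ℕ}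
    (P Q : Matrix (Fin n) (Fin n) ℝ) (R : Matrix (Fin m) (Fin m) ℝ)
    (A : Matrix (Fin n) (Fin n) ℝ) (B : Matrix (Fin n) (Fin m) ℝ)
    (hP : P.PosSemidef) (hQ : Q.PosSemidef) (hR : R.PosDef) :
    Omega P Q R A B = Phi P (Psi P R A B) Q R A B ∧
      ∀ K : Matrix (Fin m) (Fin n) ℝ,
        (Phi P K Q R A B - Omega P Q R A B).PosSemidef := by
  have hS : (R + Bᵀ * P * B).PosDef := by
    simpa only [conjTranspose_eq_transpose_of_trivial] using
      hR.add_posSemidef (hP.conjTranspose_mul_mul_same B)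
  have hΦ := Phi_eq_Omega_add (isHermitian_iff_isSymm.mp hP.isHermitian)
    (isHermitian_iff_isSymm.mp hR.isHermitian) hS.isUnit Q A
  refine ⟨by simp [hΦ], fun K => ?_⟩
  rw [hΦ, add_sub_cancel_left]
  simpa only [conjTranspose_eq_transpose_of_trivial] using
    hS.posSemidef.conjTranspose_mul_mul_same (K - Psi P R A B)
end

section
/- Define the enlarged iterates P̄_0^n = 0 ∈ ℝ^{d×d} for n = 0,…,N; P̄_{k+1}^0 = Ω(P̄_k^0, Q, R, A, B); and for n = 1,…,N, P̄_{k+1}^n = Ω((1−p^n)P̄_k^0 + p^n P̄_k^n, L_zero(Q, Q^{nn}, n, n), L_iden(R, R^{nn}, n), L_zero(A, A^{nn}, n, n), L_zero(B, B^{nn}, n, n)), where block rows/columns of A and Q are indexed 1,…,N and block columns of B and block rows/columns of R are indexed 0,…,N. Then for every k ≥ 0: P̄_k^0 = Y_k^0, and for each n = 1,…,N, P̄_k^n = L_zero(Y_k^0, Y_k^n, n, n), the d×d matrix whose (n,n) diagonal block is Y_k^n and all other blocks are zero. Consequently, the sequences Y_k^0,…,Y_k^N converge as k → ∞ if and only if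 the sequences P̄_k^0,…,P̄_k^N converge as k → ∞. -/
open Matrix Filter
open scoped Topology

/-- Spectral radius of a real square matrix. -/
noncomputable def specRad {ι : Type*} [Fintype ι] [DecidableEq ι]
    (M : Matrix ι ι ℝ) : ℝ :=
  (spectralRadius ℂ (M.map Complex.ofReal)).toReal

/-- The aggregate input matrix `B` of the `N`-plant DNCS: the `n`-th block row has
`B^{n0}` in block column `0`, `B^{nn}` in block column `n`, and zeros elsewhere. -/
def Bagg {N m₀ : ℕ} {d m : Fin N → ℕ}
    (Bn0 : ∀ i, Matrix (Fin (d i)) (Fin m₀) ℝ)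
    (Bnn : ∀ i, Matrix (Fin (d i)) (Fin (m i)) ℝ) :
    Matrix (Σ i, Fin (d i)) (Fin m₀ ⊕ (Σ i, Fin (m i))) ℝ :=
  fun a c =>
    match c with
    | Sum.inl j => Bn0 a.1 a.2 j
    | Sum.inr b => if h : b.1 = a.1 then Bnn a.1 a.2 (h ▸ b.2) else 0

/-- The `(n,n)` diagonal block of a `d×d` matrix (blocks indexed by the plants). -/
def blockGet {N : ℕ} {d : Fin N → ℕ}
    (P : Matrix (Σ i, Fin (d i)) (Σ i, Fin (d i)) ℝ) (i : Fin N) :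
    Matrix (Fin (d i)) (Fin (d i)) ℝ :=
  P.submatrix (fun x => ⟨i, x⟩) (fun x => ⟨i, x⟩)

/-- The `(n,n)` diagonal block of `R` corresponding to local controller `n`. -/
def Rblock {N m₀ : ℕ} {m : Fin N → ℕ}
    (R : Matrix (Fin m₀ ⊕ (Σ i, Fin (m i))) (Fin m₀ ⊕ (Σ i, Fin (m i))) ℝ)
    (i : Fin N) : Matrix (Fin (m i)) (Fin (m i)) ℝ :=
  R.submatrix (fun j => Sum.inr ⟨i, j⟩) (fun j => Sum.inr ⟨i, j⟩)

/-- The `N`-plant coupled Riccati iterates started from zero: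
`Y_0^0 = 0`, `Y_0^n = 0`, `Y_{k+1}^0 = Ω(Y_k^0, Q, R, A, B)`,
`Y_{k+1}^n = Ω((1−p^n)[Y_k^0]_{n,n} + p^n Y_k^n, Q^{nn}, R^{nn}, A^{nn}, B^{nn})`. -/
noncomputable def YN {N m₀ : ℕ} {d m : Fin N → ℕ}
    (Ann : ∀ i, Matrix (Fin (d i)) (Fin (d i)) ℝ)
    (Bnn : ∀ i, Matrix (Fin (d i)) (Fin (m i)) ℝ)
    (A : Matrix (Σ i, Fin (d i)) (Σ i, Fin (d i)) ℝ)
    (B : Matrix (Σ i, Fin (d i)) (Fin m₀ ⊕ (Σ i, Fin (m i))) ℝ)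
    (Q : Matrix (Σ i, Fin (d i)) (Σ i, Fin (d i)) ℝ)
    (R : Matrix (Fin m₀ ⊕ (Σ i, Fin (m i))) (Fin m₀ ⊕ (Σ i, Fin (m i))) ℝ)
    (p : Fin N → ℝ) :
    ℕ → Matrix (Σ i, Fin (d i)) (Σ i, Fin (d i)) ℝ ×
      (∀ i : Fin N, Matrix (Fin (d i)) (Fin (d i)) ℝ)
  | 0 => (0, fun _ => 0)
  | k + 1 =>
      let Y := YN Ann Bnn A B Q R p k
      (Omega Y.1 Q R A B,
       fun i => Omega ((1 - p i) • blockGet Y.1 i + p i • Y.2 i)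
         (blockGet Q i) (Rblock R i) (Ann i) (Bnn i))

/-- `L_zero(P, Q', i, i)` for `d×d` block matrices: the matrix whose `(i,i)` diagonal
block is `Q'` and all other blocks are zero. -/
def LzeroDD {N : ℕ} {d : Fin N → ℕ} (i : Fin N)
    (Q' : Matrix (Fin (d i)) (Fin (d i)) ℝ) :
    Matrix (Σ j, Fin (d j)) (Σ j, Fin (d j)) ℝ :=
  fun a b =>
    if h : a.1 = i ∧ b.1 = i then Q' (h.1 ▸ a.2) (h.2 ▸ b.2) else 0

/-- `L_zero(B, B^{nn}, n, n)` for the aggregate input matrix: the matrix whose block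
in block row `n` and (control) block column `n` is `B^{nn}`, all other blocks zero. -/
def LzeroB {N m₀ : ℕ} {d m : Fin N → ℕ} (i : Fin N)
    (B' : Matrix (Fin (d i)) (Fin (m i)) ℝ) :
    Matrix (Σ j, Fin (d j)) (Fin m₀ ⊕ (Σ j, Fin (m j))) ℝ :=
  fun a c =>
    match c with
    | Sum.inl _ => 0
    | Sum.inr b => if h : a.1 = i ∧ b.1 = i then B' (h.1 ▸ a.2) (h.2 ▸ b.2) else 0

/-- `L_iden(R, R^{nn}, n)`: the block diagonal matrix whose diagonal blocks are
identities except the `(n,n)` block which equals `R^{nn}`. -/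
def LidenR {N m₀ : ℕ} {m : Fin N → ℕ} (i : Fin N)
    (R' : Matrix (Fin (m i)) (Fin (m i)) ℝ) :
    Matrix (Fin m₀ ⊕ (Σ j, Fin (m j))) (Fin m₀ ⊕ (Σ j, Fin (m j))) ℝ :=
  fun c1 c2 =>
    match c1, c2 with
    | Sum.inl j1, Sum.inl j2 => if j1 = j2 then 1 else 0
    | Sum.inr b1, Sum.inr b2 =>
        if h : b1.1 = i ∧ b2.1 = i then R' (h.1 ▸ b1.2) (h.2 ▸ b2.2)
        else if h2 : b1.1 = b2.1 then (if h2 ▸ b1.2 = b2.2 then 1 else 0) else 0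
    | _, _ => 0

/-- The enlarged iterates `P̄_k^0, …, P̄_k^N` (all of size `d×d`). -/
noncomputable def PbarN {N m₀ : ℕ} {d m : Fin N → ℕ}
    (Ann : ∀ i, Matrix (Fin (d i)) (Fin (d i)) ℝ)
    (Bnn : ∀ i, Matrix (Fin (d i)) (Fin (m i)) ℝ)
    (A : Matrix (Σ i, Fin (d i)) (Σ i, Fin (d i)) ℝ)
    (B : Matrix (Σ i, Fin (d i)) (Fin m₀ ⊕ (Σ i, Fin (m i))) ℝ)
    (Q : Matrix (Σ i, Fin (d i)) (Σ i, Fin (d i)) ℝ)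
    (R : Matrix (Fin m₀ ⊕ (Σ i, Fin (m i))) (Fin m₀ ⊕ (Σ i, Fin (m i))) ℝ)
    (p : Fin N → ℝ) :
    ℕ → Matrix (Σ i, Fin (d i)) (Σ i, Fin (d i)) ℝ ×
      (Fin N → Matrix (Σ i, Fin (d i)) (Σ i, Fin (d i)) ℝ)
  | 0 => (0, fun _ => 0)
  | k + 1 =>
      let P := PbarN Ann Bnn A B Q R p k
      (Omega P.1 Q R A B,
       fun i => Omega ((1 - p i) • P.1 + p i • P.2 i)
         (LzeroDD i (blockGet Q i)) (LidenR (m₀ := m₀) i (Rblock R i))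
         (LzeroDD i (Ann i)) (LzeroB (m₀ := m₀) i (Bnn i)))

section Conjugation

variable {n n' m m' : Type*} [Fintype n] [Fintype n'] [Fintype m] [Fintype m']
  [DecidableEq m] [DecidableEq m']

/-- Compressing the inverse of `F M Fᵀ + (1 - F Fᵀ)` along an isometry `F` gives `M⁻¹`,
including the singular case, where both inverses are zero. -/
theorem transpose_mul_inv_conj_mul {F : Matrix m m' ℝ} (hF : Fᵀ * F = 1) (M : Matrix m' m' ℝ) :
    Fᵀ * (F * M * Fᵀ + (1 - F * Fᵀ))⁻¹ * F = M⁻¹ := by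
  have hXF : (F * M * Fᵀ + (1 - F * Fᵀ)) * F = F * M := by
    simp only [Matrix.add_mul, Matrix.sub_mul, Matrix.mul_assoc, hF, Matrix.mul_one,
      Matrix.one_mul, sub_self, add_zero]
  generalize hXdef : F * M * Fᵀ + (1 - F * Fᵀ) = X at hXF ⊢
  by_cases hX : IsUnit X.det
  · symm
    apply Matrix.inv_eq_left_inv
    rw [Matrix.mul_assoc, ← hXF, Matrix.mul_assoc, ← Matrix.mul_assoc X⁻¹,
      Matrix.nonsing_inv_mul X hX, Matrix.one_mul, hF]
  · have hM : ¬ IsUnit M.det := by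
      intro hM
      apply hX
      have hinv : X * (F * M⁻¹ * Fᵀ + (1 - F * Fᵀ)) = 1 := by
        rw [Matrix.mul_add, ← Matrix.mul_assoc, ← Matrix.mul_assoc, hXF,
          Matrix.mul_nonsing_inv_cancel_right _ _ hM, Matrix.mul_sub, Matrix.mul_one,
          ← Matrix.mul_assoc, hXF, ← hXdef]
        abel
      exact Matrix.isUnit_det_of_right_inverse hinv
    rw [Matrix.nonsing_inv_apply_not_isUnit X hX, Matrix.nonsing_inv_apply_not_isUnit M hM,
      Matrix.mul_zero, Matrix.zero_mul]

theorem Omega_conj {E : Matrix n n' ℝ} {F : Matrix m m' ℝ} (hF : Fᵀ * F = 1)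
    (P : Matrix n n ℝ) (Q : Matrix n' n' ℝ) (R : Matrix m' m' ℝ) (A : Matrix n' n' ℝ)
    (B : Matrix n' m' ℝ) :
    Omega P (E * Q * Eᵀ) (F * R * Fᵀ + (1 - F * Fᵀ)) (E * A * Eᵀ) (E * B * Fᵀ) =
      E * Omega (Eᵀ * P * E) Q R A B * Eᵀ := by
  have hX : F * R * Fᵀ + (1 - F * Fᵀ) + (E * B * Fᵀ)ᵀ * P * (E * B * Fᵀ) =
      F * (R + Bᵀ * (Eᵀ * P * E) * B) * Fᵀ + (1 - F * Fᵀ) := by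
    simp only [Matrix.transpose_mul, Matrix.transpose_transpose, Matrix.mul_add, Matrix.add_mul,
      Matrix.mul_assoc]
    abel
  unfold Omega
  rw [hX, ← transpose_mul_inv_conj_mul hF (R + _)]
  simp only [Matrix.transpose_mul, Matrix.transpose_transpose, Matrix.mul_add, Matrix.add_mul,
    Matrix.mul_sub, Matrix.sub_mul, Matrix.mul_assoc]

end Conjugation

section Embeddings

variable {N m₀ : ℕ} {d m : Fin N → ℕ}

/-- The `0`-`1` matrix whose columns are the basis vectors indexed by `f`. -/
def inclMatrix {α β : Type*} [DecidableEq β] (f : α → β) : Matrix β α ℝ :=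
  (1 : Matrix β β ℝ).submatrix id f

theorem transpose_inclMatrix_mul_mul {α β γ δ : Type*} [Fintype β] [DecidableEq β]
    [Fintype δ] [DecidableEq δ] (f : α → β) (g : γ → δ) (X : Matrix β δ ℝ) :
    (inclMatrix f)ᵀ * X * inclMatrix g = X.submatrix f g := by
  ext a c
  simp [inclMatrix, Matrix.mul_apply, Matrix.one_apply]

theorem transpose_inclMatrix_mul_self {α β : Type*} [DecidableEq α] [Fintype β] [DecidableEq β]
    {f : α → β} (hf : Function.Injective f) : (inclMatrix f)ᵀ * inclMatrix f = 1 := by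
  rw [← Matrix.mul_one (inclMatrix f)ᵀ, transpose_inclMatrix_mul_mul, Matrix.submatrix_one f hf]

/-- The inclusion of the `i`-th plant's state space into the aggregate state space. -/
abbrev stateIncl (d : Fin N → ℕ) (i : Fin N) : Matrix (Σ j, Fin (d j)) (Fin (d i)) ℝ :=
  inclMatrix fun x => ⟨i, x⟩

/-- The inclusion of the `i`-th local input space into the aggregate input space. -/
abbrev inputIncl (m₀ : ℕ) (m : Fin N → ℕ) (i : Fin N) :
    Matrix (Fin m₀ ⊕ (Σ j, Fin (m j))) (Fin (m i)) ℝ :=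
  inclMatrix fun j => Sum.inr ⟨i, j⟩

theorem LzeroDD_eq (i : Fin N) (X : Matrix (Fin (d i)) (Fin (d i)) ℝ) :
    LzeroDD i X = stateIncl d i * X * (stateIncl d i)ᵀ := by
  ext ⟨a, x⟩ ⟨b, y⟩
  by_cases ha : a = i
  · subst ha
    by_cases hb : b = a
    · subst hb
      simp [LzeroDD, inclMatrix, Matrix.mul_apply, Matrix.one_apply]
    · simp [LzeroDD, inclMatrix, Matrix.mul_apply, Matrix.one_apply, hb, Ne.symm hb]
  · simp [LzeroDD, inclMatrix, Matrix.mul_apply, Matrix.one_apply, ha]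

theorem LzeroB_eq (i : Fin N) (X : Matrix (Fin (d i)) (Fin (m i)) ℝ) :
    LzeroB (m₀ := m₀) i X = stateIncl d i * X * (inputIncl m₀ m i)ᵀ := by
  ext ⟨a, x⟩ (c | ⟨b, y⟩)
  · simp [LzeroB, inclMatrix, Matrix.mul_apply, Matrix.one_apply]
  · by_cases ha : a = i
    · subst ha
      by_cases hb : b = a
      · subst hb
        simp [LzeroB, inclMatrix, Matrix.mul_apply, Matrix.one_apply]
      · simp [LzeroB, inclMatrix, Matrix.mul_apply, Matrix.one_apply, hb, Ne.symm hb]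
    · simp [LzeroB, inclMatrix, Matrix.mul_apply, Matrix.one_apply, ha]

theorem LidenR_eq (i : Fin N) (X : Matrix (Fin (m i)) (Fin (m i)) ℝ) :
    LidenR (m₀ := m₀) i X =
      inputIncl m₀ m i * X * (inputIncl m₀ m i)ᵀ +
        (1 - inputIncl m₀ m i * (inputIncl m₀ m i)ᵀ) := by
  ext (c | ⟨a, x⟩) (c' | ⟨b, y⟩)
  · simp [LidenR, inclMatrix, Matrix.mul_apply, Matrix.one_apply]
  · simp [LidenR, inclMatrix, Matrix.mul_apply, Matrix.one_apply]
  · simp [LidenR, inclMatrix, Matrix.mul_apply, Matrix.one_apply]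
  · by_cases ha : a = i
    · subst ha
      by_cases hb : b = a
      · subst hb
        simp [LidenR, inclMatrix, Matrix.mul_apply, Matrix.one_apply]
      · simp [LidenR, inclMatrix, Matrix.mul_apply, Matrix.one_apply, hb, Ne.symm hb]
    · by_cases hb : b = a
      · subst hb
        simp [LidenR, inclMatrix, Matrix.mul_apply, Matrix.one_apply, ha]
      · simp [LidenR, inclMatrix, Matrix.mul_apply, Matrix.one_apply, ha, Ne.symm hb]

theorem blockGet_LzeroDD (i : Fin N) (X : Matrix (Fin (d i)) (Fin (d i)) ℝ) :
    blockGet (LzeroDD i X) i = X := by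
  ext x y
  simp [blockGet, LzeroDD]

theorem Omega_LzeroDD (i : Fin N) (P : Matrix (Σ j, Fin (d j)) (Σ j, Fin (d j)) ℝ)
    (Q A : Matrix (Fin (d i)) (Fin (d i)) ℝ) (R : Matrix (Fin (m i)) (Fin (m i)) ℝ)
    (B : Matrix (Fin (d i)) (Fin (m i)) ℝ) :
    Omega P (LzeroDD i Q) (LidenR (m₀ := m₀) i R) (LzeroDD i A) (LzeroB i B) =
      LzeroDD i (Omega (blockGet P i) Q R A B) := by
  have hF : Function.Injective fun j => (Sum.inr ⟨i, j⟩ : Fin m₀ ⊕ Σ j, Fin (m j)) :=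
    Sum.inr_injective.comp sigma_mk_injective
  simp only [LzeroDD_eq, LzeroB_eq, LidenR_eq]
  rw [Omega_conj (transpose_inclMatrix_mul_self hF), transpose_inclMatrix_mul_mul]
  rfl

theorem continuous_blockGet (i : Fin N) :
    Continuous fun P : Matrix (Σ j, Fin (d j)) (Σ j, Fin (d j)) ℝ => blockGet P i :=
  continuous_id.matrix_submatrix _ _

theorem continuous_LzeroDD (i : Fin N) :
    Continuous (LzeroDD i : Matrix (Fin (d i)) (Fin (d i)) ℝ → _) := by
  simp only [funext (LzeroDD_eq (d := d) i)]
  fun_prop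

theorem PbarN_eq_YN (Ann : ∀ i, Matrix (Fin (d i)) (Fin (d i)) ℝ)
    (Bnn : ∀ i, Matrix (Fin (d i)) (Fin (m i)) ℝ)
    (A : Matrix (Σ i, Fin (d i)) (Σ i, Fin (d i)) ℝ)
    (B : Matrix (Σ i, Fin (d i)) (Fin m₀ ⊕ (Σ i, Fin (m i))) ℝ)
    (Q : Matrix (Σ i, Fin (d i)) (Σ i, Fin (d i)) ℝ)
    (R : Matrix (Fin m₀ ⊕ (Σ i, Fin (m i))) (Fin m₀ ⊕ (Σ i, Fin (m i))) ℝ)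
    (p : Fin N → ℝ) (k : ℕ) :
    (PbarN Ann Bnn A B Q R p k).1 = (YN Ann Bnn A B Q R p k).1 ∧
      ∀ i : Fin N,
        (PbarN Ann Bnn A B Q R p k).2 i = LzeroDD i ((YN Ann Bnn A B Q R p k).2 i) := by
  induction k with
  | zero => exact ⟨rfl, fun i => by simp [PbarN, YN, LzeroDD_eq]⟩
  | succ k ih =>
    obtain ⟨h0, hn⟩ := ih
    refine ⟨by simp only [PbarN, YN, h0], fun i => ?_⟩
    simp only [PbarN, YN]
    have hP : blockGet ((1 - p i) • (PbarN Ann Bnn A B Q R p k).1 +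
        p i • (PbarN Ann Bnn A B Q R p k).2 i) i =
        (1 - p i) • blockGet (YN Ann Bnn A B Q R p k).1 i + p i • (YN Ann Bnn A B Q R p k).2 i := by
      rw [h0, hn]
      conv_rhs => rw [← blockGet_LzeroDD i ((YN Ann Bnn A B Q R p k).2 i)]
      rfl
    rw [Omega_LzeroDD, hP]

end Embeddings

/-- The enlarged iterates coincide (up to embedding) with the original coupled Riccati
iterates, and hence the two families converge simultaneously. -/
theorem stmt14 {N m₀ : ℕ} {d m : Fin N → ℕ}
    (Ann : ∀ i, Matrix (Fin (d i)) (Fin (d i)) ℝ)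
    (Bnn : ∀ i, Matrix (Fin (d i)) (Fin (m i)) ℝ)
    (Bn0 : ∀ i, Matrix (Fin (d i)) (Fin m₀) ℝ)
    (A : Matrix (Σ i, Fin (d i)) (Σ i, Fin (d i)) ℝ)
    (hA : A = Matrix.blockDiagonal' Ann)
    (B : Matrix (Σ i, Fin (d i)) (Fin m₀ ⊕ (Σ i, Fin (m i))) ℝ)
    (hB : B = Bagg Bn0 Bnn)
    (Q : Matrix (Σ i, Fin (d i)) (Σ i, Fin (d i)) ℝ) (hQ : Q.PosSemidef)
    (R : Matrix (Fin m₀ ⊕ (Σ i, Fin (m i))) (Fin m₀ ⊕ (Σ i, Fin (m i))) ℝ)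
    (hR : R.PosDef)
    (p : Fin N → ℝ) (hp : ∀ i, 0 ≤ p i ∧ p i ≤ 1) :
    (∀ k : ℕ,
      (PbarN Ann Bnn A B Q R p k).1 = (YN Ann Bnn A B Q R p k).1 ∧
      ∀ i : Fin N,
        (PbarN Ann Bnn A B Q R p k).2 i = LzeroDD i ((YN Ann Bnn A B Q R p k).2 i)) ∧
    (((∃ L0, Tendsto (fun k => (YN Ann Bnn A B Q R p k).1) atTop (𝓝 L0)) ∧
        ∀ i : Fin N, ∃ Li, Tendsto (fun k => (YN Ann Bnn A B Q R p k).2 i) atTop (𝓝 Li)) ↔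
      ((∃ L0, Tendsto (fun k => (PbarN Ann Bnn A B Q R p k).1) atTop (𝓝 L0)) ∧
        ∀ i : Fin N, ∃ Li, Tendsto (fun k => (PbarN Ann Bnn A B Q R p k).2 i) atTop (𝓝 Li))) := by
  have h := PbarN_eq_YN Ann Bnn A B Q R p
  refine ⟨h, ?_⟩
  simp only [fun k => (h k).1, fun k => (h k).2]
  refine and_congr_right fun _ => forall_congr' fun i => ⟨?_, ?_⟩
  · rintro ⟨L, hL⟩
    exact ⟨_, ((continuous_LzeroDD i).tendsto L).comp hL⟩
  · rintro ⟨L, hL⟩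
    refine ⟨blockGet L i, ?_⟩
    simpa only [Function.comp_def, blockGet_LzeroDD] using
      ((continuous_blockGet i).tendsto L).comp hL
end

section
/- The N-plant coupled Riccati iterates started from zero are monotonically nondecreasing in the Loewner order: for every k ≥ 0 and every n ∈ {0,1,…,N}, Y_k^n ⪯ Y_{k+1}^n. -/
open Matrix Filter
open scoped Topology

theorem Omega_eq_sub {n m : Type*} [Fintype n] [Fintype m] [DecidableEq m]
    {P : Matrix n n ℝ} (Q : Matrix n n ℝ) {R : Matrix m m ℝ} (A : Matrix n n ℝ)
    (B : Matrix n m ℝ) (hP : P.PosSemidef) (hR : R.PosDef) (L : Matrix m n ℝ) :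
    Omega P Q R A B = Q + Lᵀ * R * L + (A + B * L)ᵀ * P * (A + B * L) -
      (L + (R + Bᵀ * P * B)⁻¹ * (Bᵀ * P * A))ᵀ * (R + Bᵀ * P * B) *
        (L + (R + Bᵀ * P * B)⁻¹ * (Bᵀ * P * A)) := by
  have hPt : Pᵀ = P := by simpa using hP.isHermitian.eq
  have hS : (R + Bᵀ * P * B).PosDef :=
    hR.add_posSemidef (by simpa using hP.conjTranspose_mul_mul_same B)
  have hSt : (R + Bᵀ * P * B)ᵀ = R + Bᵀ * P * B := by simpa using hS.isHermitian.eq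
  have hdet : IsUnit (R + Bᵀ * P * B).det := (isUnit_iff_isUnit_det _).1 hS.isUnit
  have hB : Lᵀ * (R + Bᵀ * P * B) * L = Lᵀ * R * L + Lᵀ * Bᵀ * P * B * L := by
    simp only [Matrix.mul_add, Matrix.add_mul, Matrix.mul_assoc]
  unfold Omega
  generalize R + Bᵀ * P * B = S at *
  have hcancel (X : Matrix m n ℝ) : S * (S⁻¹ * X) = X := by
    rw [← Matrix.mul_assoc, mul_nonsing_inv _ hdet, Matrix.one_mul]
  have hcancel' (X : Matrix m n ℝ) : S⁻¹ * (S * X) = X := by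
    rw [← Matrix.mul_assoc, nonsing_inv_mul _ hdet, Matrix.one_mul]
  simp only [transpose_add, transpose_mul, transpose_nonsing_inv, hSt, hPt, transpose_transpose,
    Matrix.mul_add, Matrix.add_mul, Matrix.mul_assoc, hcancel, hcancel'] at hB ⊢
  rw [hB]
  abel

theorem Omega_eq_of_gain {n m : Type*} [Fintype n] [Fintype m] [DecidableEq m]
    {P : Matrix n n ℝ} (Q : Matrix n n ℝ) {R : Matrix m m ℝ} (A : Matrix n n ℝ)
    (B : Matrix n m ℝ) (hP : P.PosSemidef) (hR : R.PosDef) :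
    ∃ L : Matrix m n ℝ,
      Omega P Q R A B = Q + Lᵀ * R * L + (A + B * L)ᵀ * P * (A + B * L) :=
  ⟨-((R + Bᵀ * P * B)⁻¹ * (Bᵀ * P * A)), by
    rw [Omega_eq_sub Q A B hP hR (-((R + Bᵀ * P * B)⁻¹ * (Bᵀ * P * A))), neg_add_cancel,
      Matrix.mul_zero, sub_zero]⟩

theorem Omega_posSemidef {n m : Type*} [Fintype n] [Fintype m] [DecidableEq m]
    {P Q : Matrix n n ℝ} {R : Matrix m m ℝ} (A : Matrix n n ℝ) (B : Matrix n m ℝ)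
    (hP : P.PosSemidef) (hQ : Q.PosSemidef) (hR : R.PosDef) :
    (Omega P Q R A B).PosSemidef := by
  obtain ⟨L, hL⟩ := Omega_eq_of_gain Q A B hP hR
  rw [hL]
  exact (hQ.add (by simpa using hR.posSemidef.conjTranspose_mul_mul_same L)).add
    (by simpa only [conjTranspose_eq_transpose_of_trivial] using
      hP.conjTranspose_mul_mul_same (A + B * L))

theorem Omega_sub_posSemidef {n m : Type*} [Fintype n] [Fintype m] [DecidableEq m]
    {P P' : Matrix n n ℝ} (Q : Matrix n n ℝ) {R : Matrix m m ℝ} (A : Matrix n n ℝ)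
    (B : Matrix n m ℝ) (hP : P.PosSemidef) (hPP' : (P' - P).PosSemidef) (hR : R.PosDef) :
    (Omega P' Q R A B - Omega P Q R A B).PosSemidef := by
  have hP' : P'.PosSemidef := by simpa using hPP'.add hP
  have hS : (R + Bᵀ * P * B).PosDef :=
    hR.add_posSemidef (by simpa using hP.conjTranspose_mul_mul_same B)
  obtain ⟨L, hL⟩ := Omega_eq_of_gain Q A B hP' hR
  rw [hL, Omega_eq_sub Q A B hP hR L]
  convert (hPP'.conjTranspose_mul_mul_same (A + B * L)).add
    (hS.posSemidef.conjTranspose_mul_mul_same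
      (L + (R + Bᵀ * P * B)⁻¹ * (Bᵀ * P * A))) using 1
  simp only [conjTranspose_eq_transpose_of_trivial, Matrix.mul_sub, Matrix.sub_mul]
  abel

theorem convexCombo_blockGet_posSemidef {N : ℕ} {d : Fin N → ℕ}
    {X : Matrix (Σ i, Fin (d i)) (Σ i, Fin (d i)) ℝ} (hX : X.PosSemidef) {i : Fin N}
    {Z : Matrix (Fin (d i)) (Fin (d i)) ℝ} (hZ : Z.PosSemidef) {t : ℝ}
    (ht : 0 ≤ t ∧ t ≤ 1) : ((1 - t) • blockGet X i + t • Z).PosSemidef :=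
  ((hX.submatrix _).smul (sub_nonneg.2 ht.2)).add (hZ.smul ht.1)

theorem Rblock_posDef {N m₀ : ℕ} {m : Fin N → ℕ}
    {R : Matrix (Fin m₀ ⊕ (Σ i, Fin (m i))) (Fin m₀ ⊕ (Σ i, Fin (m i))) ℝ}
    (hR : R.PosDef) (i : Fin N) : (Rblock R i).PosDef :=
  hR.submatrix (Sum.inr_injective.comp sigma_mk_injective)

theorem YN_posSemidef {N m₀ : ℕ} {d m : Fin N → ℕ}
    (Ann : ∀ i, Matrix (Fin (d i)) (Fin (d i)) ℝ)
    (Bnn : ∀ i, Matrix (Fin (d i)) (Fin (m i)) ℝ)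
    (A : Matrix (Σ i, Fin (d i)) (Σ i, Fin (d i)) ℝ)
    (B : Matrix (Σ i, Fin (d i)) (Fin m₀ ⊕ (Σ i, Fin (m i))) ℝ)
    {Q : Matrix (Σ i, Fin (d i)) (Σ i, Fin (d i)) ℝ} (hQ : Q.PosSemidef)
    {R : Matrix (Fin m₀ ⊕ (Σ i, Fin (m i))) (Fin m₀ ⊕ (Σ i, Fin (m i))) ℝ}
    (hR : R.PosDef) {p : Fin N → ℝ} (hp : ∀ i, 0 ≤ p i ∧ p i ≤ 1) (k : ℕ) :
    (YN Ann Bnn A B Q R p k).1.PosSemidef ∧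
      ∀ i : Fin N, ((YN Ann Bnn A B Q R p k).2 i).PosSemidef := by
  induction k with
  | zero => exact ⟨.zero, fun _ => .zero⟩
  | succ k ih =>
    exact ⟨Omega_posSemidef A B ih.1 hQ hR, fun i =>
      Omega_posSemidef (Ann i) (Bnn i) (convexCombo_blockGet_posSemidef ih.1 (ih.2 i) (hp i))
        (hQ.submatrix _) (Rblock_posDef hR i)⟩

/-- The `N`-plant coupled Riccati iterates started from zero are monotonically
nondecreasing in the Loewner order. -/
theorem stmt17 {N m₀ : ℕ} {d m : Fin N → ℕ}
    (Ann : ∀ i, Matrix (Fin (d i)) (Fin (d i)) ℝ)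
    (Bnn : ∀ i, Matrix (Fin (d i)) (Fin (m i)) ℝ)
    (Bn0 : ∀ i, Matrix (Fin (d i)) (Fin m₀) ℝ)
    (A : Matrix (Σ i, Fin (d i)) (Σ i, Fin (d i)) ℝ)
    (hA : A = Matrix.blockDiagonal' Ann)
    (B : Matrix (Σ i, Fin (d i)) (Fin m₀ ⊕ (Σ i, Fin (m i))) ℝ)
    (hB : B = Bagg Bn0 Bnn)
    (Q : Matrix (Σ i, Fin (d i)) (Σ i, Fin (d i)) ℝ) (hQ : Q.PosSemidef)
    (R : Matrix (Fin m₀ ⊕ (Σ i, Fin (m i))) (Fin m₀ ⊕ (Σ i, Fin (m i))) ℝ)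
    (hR : R.PosDef)
    (p : Fin N → ℝ) (hp : ∀ i, 0 ≤ p i ∧ p i ≤ 1) :
    ∀ k : ℕ,
      ((YN Ann Bnn A B Q R p (k + 1)).1 - (YN Ann Bnn A B Q R p k).1).PosSemidef ∧
      ∀ i : Fin N,
        ((YN Ann Bnn A B Q R p (k + 1)).2 i - (YN Ann Bnn A B Q R p k).2 i).PosSemidef := by
  have hpos := YN_posSemidef Ann Bnn A B hQ hR hp
  intro k
  induction k with
  | zero =>
    have h := hpos 1
    exact ⟨by simpa [YN] using h.1, fun i => by simpa [YN] using h.2 i⟩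
  | succ k ih =>
    refine ⟨Omega_sub_posSemidef Q A B (hpos k).1 ih.1 hR, fun i =>
      Omega_sub_posSemidef _ (Ann i) (Bnn i)
        (convexCombo_blockGet_posSemidef (hpos k).1 ((hpos k).2 i) (hp i)) ?_
        (Rblock_posDef hR i)⟩
    convert convexCombo_blockGet_posSemidef ih.1 (ih.2 i) (hp i) using 1
    ext a b
    simp only [blockGet, Matrix.sub_apply, Matrix.add_apply, Matrix.smul_apply, submatrix_apply,
      smul_eq_mul]
    ring
end
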